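/- arXiv:1410.2792 — 3 statements merged into one kernel-verified Lean document; each statement's English description precedes it below -/
import Mathlib

section
/- A 2×2 real matrix M lies in the convex hull of SO(2) if and only if there exist real numbers a, b such that M = [[a, -b], [b, a]] and the symmetric 3×3 matrix [[1, 0, a], [0, 1, b], [a, b, 1]] is positive semidefinite. -/
/-- SO(2): the set of 2×2 real matrices `R` with `R * Rᵀ = 1` and `det R = 1`. -/
def SO2 : Set (Matrix (Fin 2) (Fin 2) ℝ) :=
  {R | R * R.transpose = 1 ∧ R.det = 1}

theorem posSemidef_disc_iff (a b : ℝ) :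
    (!![1, 0, a; 0, 1, b; a, b, 1] : Matrix (Fin 3) (Fin 3) ℝ).PosSemidef ↔
      a ^ 2 + b ^ 2 ≤ 1 := by
  rw [Matrix.posSemidef_iff_dotProduct_mulVec]
  constructor
  · rintro ⟨-, h⟩
    have := h ![-a, -b, 1]
    simp [Matrix.mulVec, dotProduct, Fin.sum_univ_three] at this
    linarith
  · intro h
    refine ⟨by ext i j; fin_cases i <;> fin_cases j <;> simp, fun x => ?_⟩
    simp only [Matrix.mulVec, dotProduct, Fin.sum_univ_three, star_trivial, Matrix.of_apply,
      Matrix.cons_val]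
    nlinarith [sq_nonneg (x 0 + a * x 2), sq_nonneg (x 1 + b * x 2),
      mul_nonneg (sub_nonneg.2 h) (sq_nonneg (x 2))]

theorem mem_SO2_iff (R : Matrix (Fin 2) (Fin 2) ℝ) :
    R ∈ SO2 ↔ R 1 1 = R 0 0 ∧ R 0 1 = -R 1 0 ∧ R 0 0 ^ 2 + R 1 0 ^ 2 = 1 := by
  simp only [SO2, Set.mem_ofPred_eq, ← Matrix.ext_iff, Fin.forall_fin_two, Matrix.mul_apply,
    Fin.sum_univ_two, Matrix.transpose_apply, Matrix.det_fin_two, Matrix.one_apply_eq, ne_eq,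
    zero_ne_one, one_ne_zero, not_false_eq_true, Matrix.one_apply_ne]
  constructor
  · rintro ⟨⟨⟨h₁, h₂⟩, -, h₄⟩, h₅⟩
    have h₆ : R 1 1 = R 0 0 := by
      linear_combination R 0 0 * h₄ - R 1 0 * h₂ - R 1 1 * h₅
    have h₇ : R 0 1 = -R 1 0 := by
      linear_combination -R 1 0 * h₁ + R 0 0 * h₂ - R 0 1 * h₅
    refine ⟨h₆, h₇, ?_⟩
    rw [h₇] at h₁
    linarith
  · rintro ⟨h₁, h₂, h₃⟩
    rw [h₁, h₂]
    refine ⟨⟨⟨?_, ?_⟩, ?_, ?_⟩, ?_⟩ <;> linarith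

theorem convexHull_SO2 :
    convexHull ℝ SO2 = {M | M 1 1 = M 0 0 ∧ M 0 1 = -M 1 0 ∧ M 0 0 ^ 2 + M 1 0 ^ 2 ≤ 1} := by
  apply subset_antisymm
  · refine convexHull_min (fun R hR => ?_) ?_
    · obtain ⟨h₁, h₂, h₃⟩ := (mem_SO2_iff R).1 hR
      exact ⟨h₁, h₂, h₃.le⟩
    · rintro M ⟨hM₁, hM₂, hM₃⟩ N ⟨hN₁, hN₂, hN₃⟩ s t hs ht hst
      simp only [Set.mem_ofPred_eq, Matrix.add_apply, Matrix.smul_apply, smul_eq_mul]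
      refine ⟨by rw [hM₁, hN₁], by rw [hM₂, hN₂]; ring, ?_⟩
      obtain rfl : t = 1 - s := by linarith
      nlinarith [mul_le_mul_of_nonneg_left hM₃ hs, mul_le_mul_of_nonneg_left hN₃ ht,
        mul_nonneg (mul_nonneg hs ht)
          (add_nonneg (sq_nonneg (M 0 0 - N 0 0)) (sq_nonneg (M 1 0 - N 1 0)))]
  · rintro M ⟨h₁, h₂, h₃⟩
    set s := √(1 - M 0 0 ^ 2) with hs
    have hsq : s ^ 2 = 1 - M 0 0 ^ 2 := Real.sq_sqrt (by nlinarith [sq_nonneg (M 1 0)])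
    have hb : M 1 0 ∈ segment ℝ (-s) s := by
      rw [segment_eq_Icc (by linarith [Real.sqrt_nonneg (1 - M 0 0 ^ 2)])]
      exact abs_le.1 (Real.abs_le_sqrt (by linarith))
    obtain ⟨u, v, hu, hv, huv, hb⟩ := hb
    rw [smul_eq_mul, smul_eq_mul] at hb
    have hR : ∀ y : ℝ, y ^ 2 = 1 - M 0 0 ^ 2 →
        !![M 0 0, -y; y, M 0 0] ∈ convexHull ℝ SO2 := fun y hy =>
      subset_convexHull ℝ _ ((mem_SO2_iff _).2 (by simp [hy]))
    convert convex_convexHull ℝ SO2 (hR (-s) (by rw [neg_sq, hsq])) (hR s hsq) hu hv huv using 1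
    ext i j
    fin_cases i <;> fin_cases j <;> simp [h₁, h₂]
    · linear_combination -M 0 0 * huv
    · linear_combination hb
    · linear_combination -hb
    · linear_combination -M 0 0 * huv

theorem mem_convexHull_SO2_iff_posSemidef (M : Matrix (Fin 2) (Fin 2) ℝ) :
    M ∈ convexHull ℝ SO2 ↔
      ∃ a b : ℝ, M = !![a, -b; b, a] ∧
        (!![1, 0, a; 0, 1, b; a, b, 1] : Matrix (Fin 3) (Fin 3) ℝ).PosSemidef := by
  simp only [posSemidef_disc_iff, convexHull_SO2, Set.mem_ofPred_eq]
  constructor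
  · rintro ⟨h₁, h₂, h₃⟩
    refine ⟨M 0 0, M 1 0, ?_, h₃⟩
    ext i j
    fin_cases i <;> fin_cases j <;> simp [h₁, h₂]
  · rintro ⟨a, b, rfl, h⟩
    simpa using h
end

section
/- A 3×3 real matrix X = (x_ij) lies in the convex hull of SO(3) if and only if the symmetric 4×4 matrix M(X) with rows [1 + x₁₁ + x₂₂ + x₃₃, x₃₂ − x₂₃, x₁₃ − x₃₁, x₂₁ − x₁₂], [x₃₂ − x₂₃, 1 + x₁₁ − x₂₂ − x₃₃, x₂₁ + x₁₂, x₁₃ + x₃₁], [x₁₃ − x₃₁, x₂₁ + x₁₂, 1 − x₁₁ + x₂₂ − x₃₃, x₃₂ + x₂₃], [x₂₁ − x₁₂, x₁₃ + x₃₁, x₃₂ + x₂₃, 1 − x₁₁ − x₂₂ + x₃₃] is positive semidefinite. -/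
/-- SO(3): the set of 3×3 real matrices `R` with `R * Rᵀ = 1` and `det R = 1`. -/
def SO3 : Set (Matrix (Fin 3) (Fin 3) ℝ) :=
  {R | R * R.transpose = 1 ∧ R.det = 1}

/-- The symmetric 4×4 matrix `M(X)` associated to a 3×3 matrix `X`. -/
def MX (X : Matrix (Fin 3) (Fin 3) ℝ) : Matrix (Fin 4) (Fin 4) ℝ :=
  !![1 + X 0 0 + X 1 1 + X 2 2, X 2 1 - X 1 2, X 0 2 - X 2 0, X 1 0 - X 0 1;
     X 2 1 - X 1 2, 1 + X 0 0 - X 1 1 - X 2 2, X 1 0 + X 0 1, X 0 2 + X 2 0;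
     X 0 2 - X 2 0, X 1 0 + X 0 1, 1 - X 0 0 + X 1 1 - X 2 2, X 2 1 + X 1 2;
     X 1 0 - X 0 1, X 0 2 + X 2 0, X 2 1 + X 1 2, 1 - X 0 0 - X 1 1 + X 2 2]

/-- The Euler–Rodrigues matrix of a quaternion `v`, homogeneous of degree two in `v`. -/
def rodrigues (v : Fin 4 → ℝ) : Matrix (Fin 3) (Fin 3) ℝ :=
  !![v 0 ^ 2 + v 1 ^ 2 - v 2 ^ 2 - v 3 ^ 2, 2 * (v 1 * v 2 - v 0 * v 3),
       2 * (v 1 * v 3 + v 0 * v 2);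
     2 * (v 1 * v 2 + v 0 * v 3), v 0 ^ 2 - v 1 ^ 2 + v 2 ^ 2 - v 3 ^ 2,
       2 * (v 2 * v 3 - v 0 * v 1);
     2 * (v 1 * v 3 - v 0 * v 2), 2 * (v 2 * v 3 + v 0 * v 1),
       v 0 ^ 2 - v 1 ^ 2 - v 2 ^ 2 + v 3 ^ 2]

theorem rodrigues_mul_transpose (v : Fin 4 → ℝ) :
    rodrigues v * (rodrigues v).transpose = (v ⬝ᵥ v) ^ 2 • 1 := by
  ext i j
  fin_cases i <;> fin_cases j <;>
    simp [rodrigues, Matrix.mul_apply, dotProduct, Fin.sum_univ_succ] <;> ring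

theorem det_rodrigues (v : Fin 4 → ℝ) : (rodrigues v).det = (v ⬝ᵥ v) ^ 3 := by
  simp [rodrigues, Matrix.det_fin_three, dotProduct, Fin.sum_univ_succ]
  ring

theorem rodrigues_zero : rodrigues 0 = 0 := by
  ext i j
  fin_cases i <;> fin_cases j <;> simp [rodrigues]

theorem inv_smul_rodrigues_mem_SO3 {v : Fin 4 → ℝ} (hv : v ≠ 0) :
    (v ⬝ᵥ v)⁻¹ • rodrigues v ∈ SO3 := by
  have h : v ⬝ᵥ v ≠ 0 := by simpa using hv
  constructor
  · rw [Matrix.transpose_smul, Matrix.smul_mul, Matrix.mul_smul, rodrigues_mul_transpose,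
      smul_smul, smul_smul]
    convert one_smul ℝ _
    field_simp
  · rw [Matrix.det_smul, det_rodrigues]
    simp [h]

/-- A matrix in `SO(3)` equals its own cofactor matrix. -/
theorem adjugate_eq_transpose_of_mem_SO3 {R : Matrix (Fin 3) (Fin 3) ℝ} (hR : R ∈ SO3) :
    R.adjugate = R.transpose := by
  have h : R.transpose * R = 1 := mul_eq_one_comm.mp hR.1
  calc R.adjugate = R.transpose * (R * R.adjugate) := by rw [← mul_assoc, h, one_mul]
    _ = R.transpose := by rw [Matrix.mul_adjugate, hR.2, one_smul, mul_one]

theorem isHermitian_MX (X : Matrix (Fin 3) (Fin 3) ℝ) : (MX X).IsHermitian := by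
  ext i j
  fin_cases i <;> fin_cases j <;> simp [MX]

theorem MX_mul_self_of_mem_SO3 {R : Matrix (Fin 3) (Fin 3) ℝ} (hR : R ∈ SO3) :
    MX R * MX R = (4 : ℝ) • MX R := by
  have h1 := fun i j ↦ congrFun₂ hR.1 i j
  have hR' : R.transpose * R = 1 := mul_eq_one_comm.mp hR.1
  have h2 := fun i j ↦ congrFun₂ hR' i j
  have h3 := fun i j ↦ congrFun₂ (adjugate_eq_transpose_of_mem_SO3 hR) i j
  simp [Fin.forall_fin_succ, Matrix.mul_apply, Fin.sum_univ_succ,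
    Matrix.adjugate_fin_three] at h1 h2 h3
  ext i j
  fin_cases i <;> fin_cases j <;>
    simp [MX, Matrix.mul_apply, Fin.sum_univ_succ] <;> grind

theorem posSemidef_MX_of_mem_SO3 {R : Matrix (Fin 3) (Fin 3) ℝ} (hR : R ∈ SO3) :
    (MX R).PosSemidef := by
  have h : MX R = (4⁻¹ : ℝ) • ((MX R).conjTranspose * MX R) := by
    rw [isHermitian_MX, MX_mul_self_of_mem_SO3 hR, smul_smul]
    norm_num
  rw [h]
  exact (Matrix.posSemidef_conjTranspose_mul_self _).smul (by norm_num)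

theorem MX_add_smul (X Y : Matrix (Fin 3) (Fin 3) ℝ) {a b : ℝ} (hab : a + b = 1) :
    MX (a • X + b • Y) = a • MX X + b • MX Y := by
  obtain rfl : b = 1 - a := by linarith
  ext i j
  fin_cases i <;> fin_cases j <;> simp [MX] <;> ring

theorem convex_setOf_posSemidef_MX : Convex ℝ {X | (MX X).PosSemidef} := by
  intro X hX Y hY a b ha hb hab
  rw [Set.mem_ofPred_eq, MX_add_smul X Y hab]
  exact (Matrix.PosSemidef.smul hX ha).add (Matrix.PosSemidef.smul hY hb)

theorem eq_sum_rodrigues_of_MX_eq {X : Matrix (Fin 3) (Fin 3) ℝ} {m : ℕ}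
    {v : Fin m → Fin 4 → ℝ} (h : MX X = ∑ k, Matrix.vecMulVec (v k) (v k)) :
    X = ∑ k, (4⁻¹ : ℝ) • rodrigues (v k) := by
  have h' (i j) : MX X i j = ∑ k, v k i * v k j := by
    simp [h, Matrix.sum_apply, Matrix.vecMulVec_apply]
  simp only [← Finset.smul_sum]
  ext i j
  fin_cases i <;> fin_cases j <;>
    simp [rodrigues, Matrix.sum_apply, Finset.sum_add_distrib, Finset.sum_sub_distrib,
      ← Finset.mul_sum, pow_two, ← h', MX] <;> ring

theorem sum_dotProduct_self_of_MX_eq {X : Matrix (Fin 3) (Fin 3) ℝ} {m : ℕ}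
    {v : Fin m → Fin 4 → ℝ} (h : MX X = ∑ k, Matrix.vecMulVec (v k) (v k)) :
    ∑ k, v k ⬝ᵥ v k = 4 := by
  have := congrArg Matrix.trace h
  rw [Matrix.trace_sum] at this
  simp only [Matrix.trace_vecMulVec] at this
  rw [← this]
  simp [Matrix.trace, MX, Fin.sum_univ_succ]
  ring

theorem mem_convexHull_SO3_iff_posSemidef (X : Matrix (Fin 3) (Fin 3) ℝ) :
    X ∈ convexHull ℝ SO3 ↔ (MX X).PosSemidef := by
  constructor
  · exact fun h ↦ convexHull_min (fun _ ↦ posSemidef_MX_of_mem_SO3)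
      convex_setOf_posSemidef_MX h
  · intro h
    obtain ⟨m, v, hv⟩ := Matrix.posSemidef_iff_eq_sum_vecMulVec.mp h
    simp only [star_trivial] at hv
    classical
    have hX : X = ∑ k, (v k ⬝ᵥ v k / 4) •
        (if v k = 0 then 1 else (v k ⬝ᵥ v k)⁻¹ • rodrigues (v k)) := by
      refine (eq_sum_rodrigues_of_MX_eq hv).trans (Finset.sum_congr rfl fun k _ ↦ ?_)
      split_ifs with hk
      · simp [hk, rodrigues_zero]
      · have : v k ⬝ᵥ v k ≠ 0 := by simpa using hk
        rw [smul_smul]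
        congr 1
        field_simp
    rw [hX]
    refine (convex_convexHull ℝ SO3).sum_mem (fun k _ ↦ ?_) ?_ fun k _ ↦
      subset_convexHull ℝ SO3 ?_
    · have := dotProduct_self_star_nonneg (v k)
      rw [star_trivial] at this
      positivity
    · rw [← Finset.sum_div, sum_dotProduct_self_of_MX_eq hv]
      norm_num
    · split_ifs with hk
      · simp [SO3]
      · exact inv_smul_rodrigues_mem_SO3 hk
end

section
/- Let A be an n×n real matrix admitting a decomposition A = U·Σ·Vᵀ where U, V ∈ SO(n) and Σ is a diagonal matrix with nonnegative diagonal entries. Then U·Vᵀ is a Frobenius-norm projection of A onto SO(n): for every T ∈ SO(n), ‖A − U·Vᵀ‖_F ≤ ‖A − T‖_F. -/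
/-- SO(n): the set of n×n real matrices `R` with `R * Rᵀ = 1` and `det R = 1`. -/
def SpecialOrtho (n : ℕ) : Set (Matrix (Fin n) (Fin n) ℝ) :=
  {R | R * R.transpose = 1 ∧ R.det = 1}

/-- The Frobenius norm of an n×n real matrix. -/
noncomputable def frobNorm {n : ℕ} (M : Matrix (Fin n) (Fin n) ℝ) : ℝ :=
  Real.sqrt (∑ i, ∑ j, (M i j) ^ 2)

theorem sum_sq_entries_eq_trace {n : ℕ} (M : Matrix (Fin n) (Fin n) ℝ) :
    ∑ i, ∑ j, (M i j) ^ 2 = (M * M.transpose).trace := by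
  simp [Matrix.trace, Matrix.mul_apply, sq]

/-- The Frobenius norm is invariant under orthogonal changes of basis on both sides. -/
theorem frobNorm_orthogonal_mul_mul {n : ℕ} {U V : Matrix (Fin n) (Fin n) ℝ}
    (hU : U * U.transpose = 1) (hV : V * V.transpose = 1) (M : Matrix (Fin n) (Fin n) ℝ) :
    frobNorm (U * M * V.transpose) = frobNorm M := by
  have hU' := mul_eq_one_comm.mp hU
  have hV' := mul_eq_one_comm.mp hV
  unfold frobNorm
  rw [sum_sq_entries_eq_trace, sum_sq_entries_eq_trace]
  congr 1
  calc (U * M * V.transpose * (U * M * V.transpose).transpose).trace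
      = (U * (M * (V.transpose * V) * M.transpose * U.transpose)).trace := by
        simp only [Matrix.transpose_mul, Matrix.transpose_transpose, Matrix.mul_assoc]
    _ = (M * M.transpose).trace := by
        rw [Matrix.trace_mul_comm, hV', Matrix.mul_one, Matrix.mul_assoc, hU', Matrix.mul_one]

theorem diag_le_one_of_mul_transpose_eq_one {n : ℕ} {W : Matrix (Fin n) (Fin n) ℝ}
    (hW : W * W.transpose = 1) (i : Fin n) : W i i ≤ 1 := by
  have hrow : ∑ j, W i j * W i j = 1 := by
    simpa [Matrix.mul_apply] using congrFun (congrFun hW i) i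
  have hle : W i i * W i i ≤ ∑ j, W i j * W i j :=
    Finset.single_le_sum (f := fun j => W i j * W i j) (fun j _ => mul_self_nonneg _)
      (Finset.mem_univ i)
  nlinarith

/-- The identity is a nearest orthogonal matrix to a nonnegative diagonal matrix. -/
theorem frobNorm_diagonal_sub_one_le {n : ℕ} {d : Fin n → ℝ} (hd : ∀ i, 0 ≤ d i)
    {W : Matrix (Fin n) (Fin n) ℝ} (hW : W * W.transpose = 1) :
    frobNorm (Matrix.diagonal d - 1) ≤ frobNorm (Matrix.diagonal d - W) := by
  have expand : ∀ X : Matrix (Fin n) (Fin n) ℝ, X * X.transpose = 1 →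
      ∑ i, ∑ j, ((Matrix.diagonal d - X) i j) ^ 2 =
        ∑ i, (d i ^ 2 - 2 * (d i * X i i) + 1) := by
    intro X hX
    refine Finset.sum_congr rfl fun i _ => ?_
    have hrow : ∑ j, X i j ^ 2 = 1 := by
      simpa [Matrix.mul_apply, sq] using congrFun (congrFun hX i) i
    have hterm : ∀ j, ((Matrix.diagonal d - X) i j) ^ 2 =
        (if i = j then d i ^ 2 - 2 * (d i * X i j) else 0) + X i j ^ 2 := by
      intro j
      by_cases h : i = j
      · subst h
        simp
        ring
      · simp [h]
    simp only [hterm, Finset.sum_add_distrib, hrow, Finset.sum_ite_eq, Finset.mem_univ, if_true]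
  unfold frobNorm
  rw [expand 1 (by simp), expand W hW]
  refine Real.sqrt_le_sqrt (Finset.sum_le_sum fun i _ => ?_)
  have h := mul_le_mul_of_nonneg_left (diag_le_one_of_mul_transpose_eq_one hW i) (hd i)
  rw [Matrix.one_apply_eq]
  linarith

theorem svd_projection_onto_SO (n : ℕ) (A U V : Matrix (Fin n) (Fin n) ℝ)
    (hU : U ∈ SpecialOrtho n) (hV : V ∈ SpecialOrtho n)
    (d : Fin n → ℝ) (hd : ∀ i, 0 ≤ d i)
    (hA : A = U * Matrix.diagonal d * V.transpose) :
    ∀ T ∈ SpecialOrtho n,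
      frobNorm (A - U * V.transpose) ≤ frobNorm (A - T) := by
  intro T hT
  have hU' := mul_eq_one_comm.mp hU.1
  have hW : (U.transpose * T * V) * (U.transpose * T * V).transpose = 1 := by
    calc (U.transpose * T * V) * (U.transpose * T * V).transpose
        = U.transpose * (T * (V * V.transpose) * T.transpose) * U := by
          simp only [Matrix.transpose_mul, Matrix.transpose_transpose, Matrix.mul_assoc]
      _ = 1 := by rw [hV.1, Matrix.mul_one, hT.1, Matrix.mul_one, hU']
  have hTW : T = U * (U.transpose * T * V) * V.transpose := by
    calc T = (U * U.transpose) * T * (V * V.transpose) := by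
          rw [hU.1, hV.1, Matrix.one_mul, Matrix.mul_one]
      _ = U * (U.transpose * T * V) * V.transpose := by simp only [Matrix.mul_assoc]
  have hleft : A - U * V.transpose = U * (Matrix.diagonal d - 1) * V.transpose := by
    rw [hA, Matrix.mul_sub, Matrix.sub_mul, Matrix.mul_one]
  have hright : A - T = U * (Matrix.diagonal d - U.transpose * T * V) * V.transpose := by
    rw [Matrix.mul_sub, Matrix.sub_mul, ← hTW, hA]
  rw [hleft, hright, frobNorm_orthogonal_mul_mul hU.1 hV.1,
    frobNorm_orthogonal_mul_mul hU.1 hV.1]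
  exact frobNorm_diagonal_sub_one_le hd hW
end
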